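/- For all δ₁, δ₂ ∈ [0, π/2] and all θ ∈ ℝ, it holds that 2·arcsin( √( sin²((δ₁ − δ₂)/2) + sin δ₁ · sin δ₂ · sin²(θ/2) ) ) ≤ √( δ₁² + δ₂² − 2·δ₁·δ₂·cos θ ). Equivalently, the geodesic distance on the unit sphere between the points p_i = (sin δ_i · cos θ_i, sin δ_i · sin θ_i, cos δ_i) with θ = θ₁ − θ₂ is at most the Euclidean distance between their images p'_i = (δ_i · cos θ_i, δ_i · sin θ_i) ∈ ℝ² under the mapping M. -/

import Mathlib

lemma sin_div_self_antitoneOn :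
    AntitoneOn (fun x : ℝ => Real.sin x / x) (Set.Ioc 0 Real.pi) := by
  intro a ha b hb hab
  have hc := strictConcaveOn_sin_Icc.concaveOn.2
    (Set.left_mem_Icc.2 Real.pi_pos.le) (Set.Ioc_subset_Icc_self hb)
    (sub_nonneg.2 ((div_le_one hb.1).2 hab)) (div_nonneg ha.1.le hb.1.le) (by ring)
  have hb0 : b ≠ 0 := hb.1.ne'
  simp only [smul_eq_mul, Real.sin_zero, mul_zero, zero_add, div_mul_cancel₀ a hb0] at hc
  change Real.sin b / b ≤ Real.sin a / a
  rw [le_div_iff₀ ha.1]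
  calc Real.sin b / b * a = a / b * Real.sin b := by ring
    _ ≤ Real.sin a := hc

lemma concaveOn_sin_sqrt_sq :
    ConcaveOn ℝ (Set.Icc 0 ((Real.pi / 2) ^ 2)) (fun u : ℝ => Real.sin (√u) ^ 2) := by
  have hd : ∀ u ∈ Set.Ioo (0 : ℝ) ((Real.pi / 2) ^ 2),
      HasDerivAt (fun u : ℝ => Real.sin (√u) ^ 2) (Real.sin (2 * √u) / (2 * √u)) u := by
    intro u hu
    have hs : √u ≠ 0 := (Real.sqrt_pos.2 hu.1).ne'
    refine ((Real.hasDerivAt_sqrt hu.1.ne').sin.pow 2).congr_deriv ?_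
    rw [Real.sin_two_mul]
    field_simp
    norm_num
    ring
  refine AntitoneOn.concaveOn_of_deriv (convex_Icc _ _) (by fun_prop) ?_ ?_
  · rw [interior_Icc]
    exact fun u hu => (hd u hu).differentiableAt.differentiableWithinAt
  · rw [interior_Icc]
    have hmem : ∀ u ∈ Set.Ioo (0 : ℝ) ((Real.pi / 2) ^ 2), 2 * √u ∈ Set.Ioc 0 Real.pi := by
      intro u hu
      have hlt : √u < Real.pi / 2 := (Real.sqrt_lt' (by positivity)).2 hu.2
      exact ⟨mul_pos two_pos (Real.sqrt_pos.2 hu.1), by linarith⟩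
    intro u hu v hv huv
    rw [(hd u hu).deriv, (hd v hv).deriv]
    exact sin_div_self_antitoneOn (hmem u hu) (hmem v hv)
      (mul_le_mul_of_nonneg_left (Real.sqrt_le_sqrt huv) two_pos.le)

open Real in
/-- the geodesic distance on the unit sphere between the points with polar
angles `δ₁, δ₂ ∈ [0, π/2]` and azimuthal difference `θ` is at most the Euclidean distance
between their images under the mapping `M`. -/
theorem geodesic_le_mapped_euclidean (δ₁ δ₂ θ : ℝ)
    (h₁ : δ₁ ∈ Set.Icc 0 (π/2)) (h₂ : δ₂ ∈ Set.Icc 0 (π/2)) :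
    2 * arcsin (Real.sqrt (sin ((δ₁ - δ₂)/2) ^ 2 + sin δ₁ * sin δ₂ * sin (θ/2) ^ 2)) ≤
      Real.sqrt (δ₁ ^ 2 + δ₂ ^ 2 - 2 * δ₁ * δ₂ * cos θ) := by
  obtain ⟨h10, h11⟩ := h₁
  obtain ⟨h20, h21⟩ := h₂
  set t := sin (θ/2) ^ 2 with ht
  have ht1 : t ≤ 1 := sin_sq_le_one _
  have hcos : cos θ = 1 - 2 * t := by
    rw [ht, sin_sq_eq_half_sub, mul_div_cancel₀ θ two_ne_zero]
    ring
  have hx : ((δ₁ - δ₂)/2) ^ 2 ∈ Set.Icc 0 ((π/2) ^ 2) :=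
    ⟨sq_nonneg _, sq_le_sq' (by linarith) (by linarith)⟩
  have hy : ((δ₁ + δ₂)/2) ^ 2 ∈ Set.Icc 0 ((π/2) ^ 2) :=
    ⟨sq_nonneg _, sq_le_sq' (by linarith) (by linarith)⟩
  have hw : (1 - t) • ((δ₁ - δ₂)/2) ^ 2 + t • ((δ₁ + δ₂)/2) ^ 2 ∈ Set.Icc 0 ((π/2) ^ 2) :=
    convex_Icc _ _ hx hy (sub_nonneg.2 ht1) (sq_nonneg _) (by ring)
  have hc := concaveOn_sin_sqrt_sq.2 hx hy (sub_nonneg.2 ht1) (sq_nonneg _) (by ring)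
  set w := (1 - t) • ((δ₁ - δ₂)/2) ^ 2 + t • ((δ₁ + δ₂)/2) ^ 2 with hwdef
  have hE : δ₁ ^ 2 + δ₂ ^ 2 - 2 * δ₁ * δ₂ * cos θ = 2 ^ 2 * w := by
    rw [hcos, hwdef, smul_eq_mul, smul_eq_mul]
    ring
  have hsin : sin ((δ₁ + δ₂)/2) ^ 2 = sin ((δ₁ - δ₂)/2) ^ 2 + sin δ₁ * sin δ₂ := by
    rw [sin_sq_eq_half_sub, sin_sq_eq_half_sub, mul_div_cancel₀ _ two_ne_zero,
      mul_div_cancel₀ _ two_ne_zero, cos_add, cos_sub]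
    ring
  have habs : sin |(δ₁ - δ₂)/2| ^ 2 = sin ((δ₁ - δ₂)/2) ^ 2 := by
    rcases abs_choice ((δ₁ - δ₂)/2) with h | h <;> rw [h]
    rw [sin_neg, neg_sq]
  have hsw : √w ≤ π/2 := Real.sqrt_le_iff.2 ⟨by positivity, hw.2⟩
  have hw0 : 0 ≤ √w := Real.sqrt_nonneg w
  rw [hE, Real.sqrt_mul (by norm_num), Real.sqrt_sq two_pos.le]
  refine mul_le_mul_of_nonneg_left ?_ two_pos.le
  rw [← arcsin_sin (by linarith [pi_pos]) hsw]
  refine monotone_arcsin (Real.sqrt_le_iff.2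
    ⟨sin_nonneg_of_nonneg_of_le_pi hw0 (by linarith [pi_pos]), ?_⟩)
  simp only [smul_eq_mul, Real.sqrt_sq_eq_abs, habs,
    abs_of_nonneg (show 0 ≤ (δ₁ + δ₂)/2 by linarith), hsin] at hc
  linarith
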